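/- arXiv:1506.01670 — 3 statements merged into one kernel-verified Lean document; each statement's English description precedes it below -/
import Mathlib

section
/- For all complex numbers A, B and every real α, the integral over θ from 0 to 2π of exp(2A·cos(θ−α) + 2B·cos(θ)) dθ equals 2π·E(A² + 2AB·cos(α) + B²), where E(z) = Σ_{k=0}^∞ z^k/(k!)² is the entire function satisfying I₀(2√z) = E(z) for the modified Bessel function I₀ of the first kind. -/
open MeasureTheory

/-- The entire function `E (z) = ∑ z^k/(k!)²`, satisfying `I₀(2√z) = E z`. -/
noncomputable def E (z : ℂ) : ℂ := ∑' k : ℕ, z ^ k / ((Nat.factorial k : ℂ)) ^ 2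

theorem integral_exp_int_mul_I (k : ℤ) :
    ∫ θ in (0:ℝ)..(2 * Real.pi), Complex.exp (k * Complex.I * θ)
      = if k = 0 then (2 * Real.pi : ℂ) else 0 := by
  split_ifs with h
  · simp [h]
  · have hc : (k : ℂ) * Complex.I ≠ 0 := by simp [h]
    rw [integral_exp_mul_complex hc]
    have h1 : (k : ℂ) * Complex.I * ((2 * Real.pi : ℝ) : ℂ)
        = k * (2 * Real.pi * Complex.I) := by push_cast; ring
    rw [h1, Complex.exp_int_mul_two_pi_mul_I]
    simp

/-- The generating function of the Fourier modes, `exp (p w + q / w)` with `w = exp (iθ)`, has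
mean value `E (p q)`. -/
theorem integral_exp_fourier_pair (p q : ℂ) :
    ∫ θ in (0:ℝ)..(2 * Real.pi),
        Complex.exp (p * Complex.exp (θ * Complex.I) + q * Complex.exp (-θ * Complex.I))
      = 2 * Real.pi * E (p * q) := by
  let F : ℕ × ℕ → ℝ → ℂ := fun m θ =>
    (p * Complex.exp (θ * Complex.I)) ^ m.1 / (Nat.factorial m.1 : ℂ) *
      ((q * Complex.exp (-θ * Complex.I)) ^ m.2 / (Nat.factorial m.2 : ℂ))
  let bound : ℕ × ℕ → ℝ := fun m =>
    ‖p‖ ^ m.1 / (Nat.factorial m.1 : ℝ) * (‖q‖ ^ m.2 / (Nat.factorial m.2 : ℝ))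
  have hbound : Summable bound :=
    (Real.summable_pow_div_factorial ‖p‖).mul_of_nonneg (Real.summable_pow_div_factorial ‖q‖)
      (fun _ => by positivity) (fun _ => by positivity)
  have hnorm : ∀ m θ, ‖F m θ‖ = bound m := by
    intro m θ
    have hneg : ‖Complex.exp (-(θ : ℂ) * Complex.I)‖ = 1 := by
      simpa using Complex.norm_exp_ofReal_mul_I (-θ)
    simp only [F, bound, norm_mul, norm_div, norm_pow, Complex.norm_exp_ofReal_mul_I, hneg,
      mul_one, Complex.norm_natCast]
  have hexp : ∀ z : ℂ, HasSum (fun n : ℕ => z ^ n / (Nat.factorial n : ℂ)) (Complex.exp z) := by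
    intro z
    rw [Complex.exp_eq_exp_ℂ]
    exact NormedSpace.expSeries_div_hasSum_exp z
  have hsum : HasSum (fun m => ∫ θ in (0:ℝ)..(2 * Real.pi), F m θ)
      (∫ θ in (0:ℝ)..(2 * Real.pi),
        Complex.exp (p * Complex.exp (θ * Complex.I) + q * Complex.exp (-θ * Complex.I))) := by
    refine intervalIntegral.hasSum_integral_of_dominated_convergence (fun m _ => bound m)
      (fun m => ?_) (fun m => ?_) ?_ ?_ ?_
    · exact Continuous.aestronglyMeasurable (by fun_prop)
    · exact .of_forall fun θ _ => (hnorm m θ).le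
    · exact .of_forall fun _ _ => hbound
    · exact intervalIntegrable_const
    · refine .of_forall fun θ _ => ?_
      rw [Complex.exp_add]
      have hF : Summable fun m => F m θ := .of_norm (by simpa only [hnorm] using hbound)
      have h₁ := hexp (p * Complex.exp (θ * Complex.I))
      have h₂ := hexp (q * Complex.exp (-θ * Complex.I))
      have h₁₂ := h₁.mul h₂ hF
      exact h₁₂
  have hint : ∀ m : ℕ × ℕ, ∫ θ in (0:ℝ)..(2 * Real.pi), F m θ =
      p ^ m.1 / (Nat.factorial m.1 : ℂ) * (q ^ m.2 / (Nat.factorial m.2 : ℂ)) *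
        if (m.1 : ℤ) - m.2 = 0 then (2 * Real.pi : ℂ) else 0 := by
    intro m
    rw [← integral_exp_int_mul_I, ← intervalIntegral.integral_const_mul]
    refine intervalIntegral.integral_congr fun θ _ => ?_
    have hmode : Complex.exp ((((m.1 : ℤ) - m.2 : ℤ) : ℂ) * Complex.I * θ) =
        Complex.exp (θ * Complex.I) ^ m.1 * Complex.exp (-θ * Complex.I) ^ m.2 := by
      rw [← Complex.exp_nat_mul, ← Complex.exp_nat_mul, ← Complex.exp_add]
      congr 1
      push_cast
      ring
    simp only [F, hmode, mul_pow]
    ring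
  have hinj : Function.Injective fun n : ℕ => (n, n) := fun a b h => congrArg Prod.fst h
  rw [← hinj.hasSum_iff] at hsum
  · rw [← hsum.tsum_eq, E, ← tsum_mul_left]
    refine tsum_congr fun n => ?_
    simp only [Function.comp_apply, hint, sub_self, if_true, mul_pow]
    ring
  · rintro ⟨a, b⟩ hab
    have hne : (a : ℤ) - b ≠ 0 := fun h => hab ⟨a, by simp; omega⟩
    simp only [hint, if_neg hne, mul_zero]

theorem integral_exp_two_cos (A B : ℂ) (α : ℝ) :
    ∫ θ in (0:ℝ)..(2 * Real.pi),
        Complex.exp (2 * A * Real.cos (θ - α) + 2 * B * Real.cos θ)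
      = 2 * Real.pi * E (A ^ 2 + 2 * A * B * Real.cos α + B ^ 2) := by
  have hα : Complex.exp (α * Complex.I) * Complex.exp (-α * Complex.I) = 1 := by
    rw [← Complex.exp_add]
    simp
  have hpq : A ^ 2 + 2 * A * B * Real.cos α + B ^ 2 =
      (A * Complex.exp (-α * Complex.I) + B) * (A * Complex.exp (α * Complex.I) + B) := by
    rw [Complex.ofReal_cos, Complex.cos]
    linear_combination -A ^ 2 * hα
  rw [hpq, ← integral_exp_fourier_pair]
  refine intervalIntegral.integral_congr fun θ _ => ?_
  have h₁ : Complex.exp ((θ - α) * Complex.I) =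
      Complex.exp (-α * Complex.I) * Complex.exp (θ * Complex.I) := by
    rw [← Complex.exp_add]
    ring_nf
  have h₂ : Complex.exp (-(θ - α) * Complex.I) =
      Complex.exp (α * Complex.I) * Complex.exp (-θ * Complex.I) := by
    rw [← Complex.exp_add]
    ring_nf
  simp only [Complex.ofReal_cos, Complex.cos, Complex.ofReal_sub, h₁, h₂]
  congr 1
  ring
end

section
/- Let λ > 0, let q ≥ 0, r ≥ 0 and α, φ ∈ ℝ, and let h : ℝ → ℂ be a bounded measurable function supported in an interval [0, R] with R > 0. Then the double integral F(r,φ;q,α) = (1/π)·∫_0^∞ ∫_0^{2π} exp(−λ(q² + ρ² − 2ρq·cos(θ−α)))·exp(2πi·rρ·cos(θ−φ))·h(ρ)·ρ dθ dρ equals e^{−λq²}·∫_0^∞ e^{−λt}·E(t·Ω)·h(√t) dt, where Ω = Ω(r,φ;q,α) = λ²q² + 2πi·rλq·cos(φ−α) − π²r² and E(z) = Σ_{k=0}^∞ z^k/(k!)². -/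
open MeasureTheory

/-- `Ω(r,φ;q,α) = λ²q² + 2πi·rλq·cos(φ−α) − π²r²` (shape parameter `l`). -/
noncomputable def Om (l r φ q α : ℝ) : ℂ :=
  (l : ℂ) ^ 2 * (q : ℂ) ^ 2
    + 2 * (Real.pi : ℂ) * Complex.I * (r : ℂ) * (l : ℂ) * (q : ℂ) * (Real.cos (φ - α) : ℂ)
    - (Real.pi : ℂ) ^ 2 * (r : ℂ) ^ 2

/-- Termwise integration of `f * exp (A * u)` for a continuous unimodular `u`. -/
lemma hasSum_integral_mul_exp (f u : ℝ → ℂ) (hf : Continuous f) (hu : Continuous u)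
    (hu1 : ∀ x, ‖u x‖ = 1) (A : ℂ) (a b : ℝ) :
    HasSum (fun k : ℕ => A ^ k / (Nat.factorial k : ℂ) * ∫ x in a..b, f x * u x ^ k)
      (∫ x in a..b, f x * Complex.exp (A * u x)) := by
  simp only [← intervalIntegral.integral_const_mul]
  have hs := NormedSpace.expSeries_div_hasSum_exp ‖A‖
  refine intervalIntegral.hasSum_integral_of_dominated_convergence
    (fun k x => ‖f x‖ * (‖A‖ ^ k / (Nat.factorial k : ℝ))) ?_ ?_ ?_ ?_ ?_
  · intro k
    exact (by fun_prop : Continuous fun x : ℝ => A ^ k / (Nat.factorial k : ℂ) * (f x * u x ^ k))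
      |>.aestronglyMeasurable
  · intro k
    refine .of_forall fun x _ => le_of_eq ?_
    simp only [norm_mul, norm_div, norm_pow, hu1, Complex.norm_natCast]
    ring
  · exact .of_forall fun x _ => hs.summable.mul_left _
  · simp only [tsum_mul_left]
    exact (hf.norm.mul continuous_const).intervalIntegrable _ _
  · refine .of_forall fun x _ => ?_
    have h := (NormedSpace.expSeries_div_hasSum_exp (A * u x)).mul_left (f x)
    rw [← Complex.exp_eq_exp_ℂ] at h
    convert! h using 2 with k
    rw [mul_pow]
    ring

lemma norm_exp_mul_I_eq_one (x : ℝ) : ‖Complex.exp (x * Complex.I)‖ = 1 :=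
  Complex.norm_exp_ofReal_mul_I x

lemma norm_exp_neg_mul_I_eq_one (x : ℝ) : ‖Complex.exp (-(x * Complex.I))‖ = 1 := by
  simpa using Complex.norm_exp_ofReal_mul_I (-x)

/-- Orthogonality of the characters of the circle. -/
lemma integral_exp_pow_mul_exp_neg_pow (k j : ℕ) :
    ∫ x in (0 : ℝ)..(2 * Real.pi),
        Complex.exp (x * Complex.I) ^ k * Complex.exp (-(x * Complex.I)) ^ j
      = if j = k then 2 * (Real.pi : ℂ) else 0 := by
  have h (x : ℝ) : Complex.exp (x * Complex.I) ^ k * Complex.exp (-(x * Complex.I)) ^ j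
      = Complex.exp ((((k : ℤ) - j : ℤ) * Complex.I) * x) := by
    rw [← Complex.exp_nat_mul, ← Complex.exp_nat_mul, ← Complex.exp_add]
    congr 1
    push_cast
    ring
  simp only [h]
  split_ifs with hjk
  · simp [hjk]
  · have hne : (((k : ℤ) - j : ℤ) : ℂ) * Complex.I ≠ 0 := by
      refine mul_ne_zero ?_ Complex.I_ne_zero
      exact Int.cast_ne_zero.mpr fun h0 => hjk (by omega)
    rw [integral_exp_mul_complex hne]
    have : (((k : ℤ) - j : ℤ) : ℂ) * Complex.I * ((2 * Real.pi : ℝ) : ℂ)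
        = (((k : ℤ) - j : ℤ) : ℂ) * (2 * Real.pi * Complex.I) := by
      push_cast
      ring
    rw [this, Complex.exp_int_mul_two_pi_mul_I]
    simp

lemma integral_exp_pow_mul_exp_exp_neg (B : ℂ) (k : ℕ) :
    ∫ x in (0 : ℝ)..(2 * Real.pi),
        Complex.exp (x * Complex.I) ^ k * Complex.exp (B * Complex.exp (-(x * Complex.I)))
      = B ^ k / (Nat.factorial k : ℂ) * (2 * Real.pi) := by
  have h := hasSum_integral_mul_exp (fun x : ℝ => Complex.exp (x * Complex.I) ^ k)
    (fun x : ℝ => Complex.exp (-(x * Complex.I))) (by fun_prop) (by fun_prop)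
    norm_exp_neg_mul_I_eq_one B 0 (2 * Real.pi)
  simp only [integral_exp_pow_mul_exp_neg_pow] at h
  refine h.unique ?_
  simpa using hasSum_single (f := fun j : ℕ =>
    B ^ j / (Nat.factorial j : ℂ) * if j = k then 2 * (Real.pi : ℂ) else 0) k
    fun j hj => by simp [hj]

/-- The circular average of `exp (A e^{iθ} + B e^{-iθ})`. -/
lemma integral_exp_circle (A B : ℂ) :
    ∫ x in (0 : ℝ)..(2 * Real.pi),
        Complex.exp (A * Complex.exp (x * Complex.I) + B * Complex.exp (-(x * Complex.I)))
      = 2 * Real.pi * E (A * B) := by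
  have h := hasSum_integral_mul_exp
    (fun x : ℝ => Complex.exp (B * Complex.exp (-(x * Complex.I))))
    (fun x : ℝ => Complex.exp (x * Complex.I)) (by fun_prop) (by fun_prop)
    norm_exp_mul_I_eq_one A 0 (2 * Real.pi)
  have hk (k : ℕ) := integral_exp_pow_mul_exp_exp_neg B k
  simp only [mul_comm (Complex.exp (_ * Complex.I) ^ _)] at hk
  simp only [hk, ← Complex.exp_add] at h
  simp only [add_comm (A * _)]
  rw [← h.tsum_eq, E, ← tsum_mul_left]
  refine tsum_congr fun k => ?_
  rw [mul_pow]
  ring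

/-- The angular integral of the shifted Gaussian against the Fourier kernel. -/
lemma integral_gaussian_fourier_angular (l q r α φ ρ : ℝ) :
    ∫ θ in (0:ℝ)..(2 * Real.pi),
        Complex.exp (-(l : ℂ) * ((q:ℂ)^2 + (ρ:ℂ)^2 - 2 * (ρ:ℂ) * (q:ℂ) * (Real.cos (θ - α) : ℂ)))
          * Complex.exp
            (2 * (Real.pi : ℂ) * Complex.I * (r:ℂ) * (ρ:ℂ) * (Real.cos (θ - φ) : ℂ))
      = Complex.exp (-(l : ℂ) * ((q:ℂ)^2 + (ρ:ℂ)^2))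
          * (2 * Real.pi * E ((ρ:ℂ)^2 * Om l r φ q α)) := by
  set A : ℂ := l * ρ * q * Complex.exp (-(α * Complex.I))
    + Real.pi * Complex.I * r * ρ * Complex.exp (-(φ * Complex.I)) with hA
  set B : ℂ := l * ρ * q * Complex.exp (α * Complex.I)
    + Real.pi * Complex.I * r * ρ * Complex.exp (φ * Complex.I) with hB
  have hcos (x y : ℝ) : 2 * (Real.cos (x - y) : ℂ)
      = Complex.exp (x * Complex.I) * Complex.exp (-(y * Complex.I))
        + Complex.exp (-(x * Complex.I)) * Complex.exp (y * Complex.I) := by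
    rw [Complex.ofReal_cos, Complex.two_cos, ← Complex.exp_add, ← Complex.exp_add]
    push_cast
    ring_nf
  have hinv (x : ℝ) : Complex.exp (x * Complex.I) * Complex.exp (-(x * Complex.I)) = 1 := by
    rw [← Complex.exp_add, add_neg_cancel, Complex.exp_zero]
  have hAB : A * B = (ρ:ℂ)^2 * Om l r φ q α := by
    rw [hA, hB, Om]
    linear_combination ((l : ℂ) * ρ * q)^2 * hinv α
      + (Real.pi * Complex.I * r * ρ : ℂ)^2 * hinv φ
      - (l * ρ^2 * q * Real.pi * Complex.I * r : ℂ) * hcos φ α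
      + (Real.pi * r * ρ : ℂ)^2 * Complex.I_sq
  rw [← hAB, ← integral_exp_circle, ← intervalIntegral.integral_const_mul]
  refine intervalIntegral.integral_congr fun θ _ => ?_
  simp only [← Complex.exp_add]
  congr 1
  rw [hA, hB]
  linear_combination (l * ρ * q : ℂ) * hcos θ α
    + (Real.pi * Complex.I * r * ρ : ℂ) * hcos θ φ

theorem fourier_integral_GRBF (l : ℝ) (hl : 0 < l) (q r : ℝ) (hq : 0 ≤ q) (hr : 0 ≤ r)
    (α φ : ℝ) (R : ℝ) (hR : 0 < R) (h : ℝ → ℂ) (hmeas : Measurable h)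
    (C : ℝ) (hbd : ∀ x : ℝ, ‖h x‖ ≤ C) (hsupp : ∀ x : ℝ, x ∉ Set.Icc 0 R → h x = 0) :
    (1 / (Real.pi : ℂ)) *
        ∫ ρ in Set.Ioi (0:ℝ),
          (∫ θ in (0:ℝ)..(2 * Real.pi),
            Complex.exp (-(l : ℂ) * ((q:ℂ)^2 + (ρ:ℂ)^2 - 2 * (ρ:ℂ) * (q:ℂ) * (Real.cos (θ - α) : ℂ)))
              * Complex.exp (2 * (Real.pi : ℂ) * Complex.I * (r:ℂ) * (ρ:ℂ) * (Real.cos (θ - φ) : ℂ))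
              * h ρ * (ρ:ℂ))
      = Complex.exp (-(l : ℂ) * (q:ℂ)^2) *
          ∫ t in Set.Ioi (0:ℝ),
            Complex.exp (-(l : ℂ) * (t:ℂ)) * E ((t:ℂ) * Om l r φ q α) * h (Real.sqrt t) := by
  rw [← integral_comp_rpow_Ioi_of_pos (p := 2) two_pos (g := fun t : ℝ =>
    Complex.exp (-(l : ℂ) * (t : ℂ)) * E ((t : ℂ) * Om l r φ q α) * h (Real.sqrt t)), ← integral_const_mul, ← integral_const_mul]
  refine setIntegral_congr_fun measurableSet_Ioi fun ρ hρ => ?_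
  have hρ0 : 0 ≤ ρ := le_of_lt hρ
  have hpi : (Real.pi : ℂ) ≠ 0 := Complex.ofReal_ne_zero.mpr Real.pi_ne_zero
  have hexp : Complex.exp (-(l : ℂ) * ((q:ℂ)^2 + (ρ:ℂ)^2))
      = Complex.exp (-(l : ℂ) * (q:ℂ)^2) * Complex.exp (-(l : ℂ) * (ρ:ℂ)^2) := by
    rw [← Complex.exp_add, mul_add]
  have h21 : (2 : ℝ) - 1 = 1 := by norm_num
  simp only [intervalIntegral.integral_mul_const, integral_gaussian_fourier_angular, h21,
    Real.rpow_one, Real.rpow_two, Real.sqrt_sq hρ0, Complex.real_smul, hexp]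
  push_cast
  field_simp
end

section
/- Let λ > 0, q ≥ 0, r ≥ 0 and α, φ ∈ ℝ. Then (1/π)·∫_0^1 ∫_0^{2π} exp(−λ(q² + ρ² − 2ρq·cos(θ−α)))·exp(2πi·rρ·cos(θ−φ))·ρ dθ dρ = e^{−λq²}·Σ_{s=0}^∞ (m_s(λ)/(s!)²)·Ω^s, where Ω = λ²q² + 2πi·rλq·cos(φ−α) − π²r² and m_s(λ) = ∫_0^1 e^{−λρ}·ρ^s dρ; moreover the series on the right converges absolutely. -/
open MeasureTheory

/-- `m_s(λ) = ∫_0^1 e^{−λρ}·ρ^s dρ`. -/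
noncomputable def m (s : ℕ) (l : ℂ) : ℂ :=
  ∫ ρ in (0:ℝ)..1, Complex.exp (-l * (ρ:ℂ)) * (ρ:ℂ) ^ s

lemma integral_exp_mul_I_pow_mul_exp_neg_mul_I_pow (j k : ℕ) :
    ∫ θ in (0:ℝ)..(2 * Real.pi), Complex.exp (θ * Complex.I) ^ j * Complex.exp (-(θ * Complex.I)) ^ k
      = if j = k then 2 * (Real.pi : ℂ) else 0 := by
  have h : ∀ θ : ℝ, Complex.exp (θ * Complex.I) ^ j * Complex.exp (-(θ * Complex.I)) ^ k
      = Complex.exp ((((j : ℂ) - k) * Complex.I) * θ) := by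
    intro θ
    rw [← Complex.exp_nat_mul, ← Complex.exp_nat_mul, ← Complex.exp_add]
    congr 1
    ring
  simp_rw [h]
  split_ifs with hjk
  · simp [hjk]
  · have hne : ((j : ℂ) - k) * Complex.I ≠ 0 :=
      mul_ne_zero (sub_ne_zero.2 (by exact_mod_cast hjk)) Complex.I_ne_zero
    rw [integral_exp_mul_complex hne]
    have := Complex.exp_int_mul_two_pi_mul_I ((j : ℤ) - k)
    push_cast at this
    rw [show ((j : ℂ) - k) * Complex.I * ((2 * Real.pi : ℝ) : ℂ)
      = ((j : ℂ) - k) * (2 * Real.pi * Complex.I) by push_cast; ring, this]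
    simp

/-- The generating-function form of the modified Bessel function `I₀`. -/
lemma hasSum_integral_exp_circle (a b : ℂ) :
    HasSum (fun s : ℕ => 2 * (Real.pi : ℂ) * ((a * b) ^ s / (s.factorial : ℂ) ^ 2))
      (∫ θ in (0:ℝ)..(2 * Real.pi),
        Complex.exp (a * Complex.exp (θ * Complex.I) + b * Complex.exp (-(θ * Complex.I)))) := by
  have hexp : ∀ z : ℂ, HasSum (fun n : ℕ => z ^ n / (n.factorial : ℂ)) (Complex.exp z) := by
    intro z
    rw [Complex.exp_eq_exp_ℂ]
    exact NormedSpace.expSeries_div_hasSum_exp z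
  have hnorm : ∀ z : ℂ, Summable (fun n : ℕ => ‖z ^ n / (n.factorial : ℂ)‖) :=
    fun z => (hexp z).summable.norm
  have hprod : ∀ z w : ℂ, HasSum (fun p : ℕ × ℕ =>
      (z ^ p.1 / (p.1.factorial : ℂ)) * (w ^ p.2 / (p.2.factorial : ℂ))) (Complex.exp (z + w)) := by
    intro z w
    have hs := summable_mul_of_summable_norm (hnorm z) (hnorm w)
    rw [hs.hasSum_iff, ← tsum_mul_tsum_of_summable_norm (hnorm z) (hnorm w), (hexp z).tsum_eq,
      (hexp w).tsum_eq, Complex.exp_add]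
  have hdom := intervalIntegral.hasSum_integral_of_dominated_convergence (μ := volume)
    (a := 0) (b := 2 * Real.pi)
    (F := fun (p : ℕ × ℕ) (θ : ℝ) =>
      ((a * Complex.exp (θ * Complex.I)) ^ p.1 / (p.1.factorial : ℂ)) *
        ((b * Complex.exp (-(θ * Complex.I))) ^ p.2 / (p.2.factorial : ℂ)))
    (f := fun θ : ℝ =>
      Complex.exp (a * Complex.exp (θ * Complex.I) + b * Complex.exp (-(θ * Complex.I))))
    (fun p _ => ‖a ^ p.1 / (p.1.factorial : ℂ)‖ * ‖b ^ p.2 / (p.2.factorial : ℂ)‖)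
    (fun p => (by fun_prop : Continuous _).aestronglyMeasurable)
    (fun p => .of_forall fun θ _ => by
      have h1 : ‖Complex.exp (θ * Complex.I)‖ = 1 := Complex.norm_exp_ofReal_mul_I θ
      have h2 : ‖Complex.exp (-(θ * Complex.I))‖ = 1 := by
        simpa using Complex.norm_exp_ofReal_mul_I (-θ)
      simp [h1, h2])
    (.of_forall fun θ _ =>
      (hnorm a).mul_of_nonneg (hnorm b) (fun _ => norm_nonneg _) fun _ => norm_nonneg _)
    (by simp)
    (.of_forall fun θ _ => hprod _ _)
  have hterm : ∀ p : ℕ × ℕ, ∫ θ in (0:ℝ)..(2 * Real.pi),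
      ((a * Complex.exp (θ * Complex.I)) ^ p.1 / (p.1.factorial : ℂ)) *
        ((b * Complex.exp (-(θ * Complex.I))) ^ p.2 / (p.2.factorial : ℂ))
      = (a ^ p.1 / (p.1.factorial : ℂ)) * (b ^ p.2 / (p.2.factorial : ℂ)) *
        if p.1 = p.2 then 2 * (Real.pi : ℂ) else 0 := by
    intro p
    rw [← integral_exp_mul_I_pow_mul_exp_neg_mul_I_pow, ← intervalIntegral.integral_const_mul]
    congr 1 with θ
    ring
  simp_rw [hterm] at hdom
  have hinj : Function.Injective (fun s : ℕ => (s, s)) := fun x y h => congrArg Prod.fst h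
  rw [← hinj.hasSum_iff] at hdom
  · refine hdom.congr_fun fun s => ?_
    simp only [Function.comp_apply, if_true]
    ring
  · rintro ⟨j, k⟩ hp
    rw [if_neg, mul_zero]
    rintro (rfl : j = k)
    exact hp ⟨_, rfl⟩

lemma two_mul_integral_gaussian_pow (s : ℕ) (l : ℂ) :
    2 * ∫ ρ in (0:ℝ)..1, Complex.exp (-l * (ρ:ℂ) ^ 2) * ((ρ:ℂ) ^ 2) ^ s * ρ = m s l := by
  have h := intervalIntegral.integral_deriv_smul_comp (a := 0) (b := 1)
    (f := fun x : ℝ => x ^ 2) (f' := fun x : ℝ => 2 * x)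
    (g := fun u : ℝ => Complex.exp (-l * (u:ℂ)) * (u:ℂ) ^ s)
    (fun x _ => by simpa using hasDerivAt_pow 2 x) (by fun_prop) (by fun_prop)
  norm_num at h
  rw [m, ← intervalIntegral.integral_const_mul]
  simp only [neg_mul]
  rw [← h]
  congr 1 with ρ
  ring

lemma hasSum_m_mul_pow (l a b : ℂ) :
    HasSum (fun s : ℕ => (m s l / (s.factorial : ℂ) ^ 2) * (a * b) ^ s)
      ((1 / (Real.pi : ℂ)) * ∫ ρ in (0:ℝ)..1, Complex.exp (-l * (ρ:ℂ) ^ 2) *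
        (∫ θ in (0:ℝ)..(2 * Real.pi), Complex.exp ((ρ * a) * Complex.exp (θ * Complex.I)
          + (ρ * b) * Complex.exp (-(θ * Complex.I)))) * ρ) := by
  have hpi : (Real.pi : ℂ) ≠ 0 := by exact_mod_cast Real.pi_ne_zero
  obtain ⟨C, hC⟩ := (isCompact_Icc (a := (0:ℝ)) (b := 1)).exists_bound_of_continuousOn
    (f := fun ρ : ℝ => Complex.exp (-l * (ρ:ℂ) ^ 2)) (by fun_prop)
  have hdom := intervalIntegral.hasSum_integral_of_dominated_convergence (μ := volume)
    (a := 0) (b := 1)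
    (F := fun (s : ℕ) (ρ : ℝ) => Complex.exp (-l * (ρ:ℂ) ^ 2) *
      (2 * (Real.pi : ℂ) * ((ρ * a * (ρ * b)) ^ s / (s.factorial : ℂ) ^ 2)) * ρ)
    (f := fun ρ : ℝ => Complex.exp (-l * (ρ:ℂ) ^ 2) *
      (∫ θ in (0:ℝ)..(2 * Real.pi), Complex.exp ((ρ * a) * Complex.exp (θ * Complex.I)
          + (ρ * b) * Complex.exp (-(θ * Complex.I)))) * ρ)
    (fun s _ => C * ‖2 * (Real.pi : ℂ) * ((a * b) ^ s / (s.factorial : ℂ) ^ 2)‖)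
    (fun s => (by fun_prop : Continuous _).aestronglyMeasurable)
    (fun s => .of_forall fun ρ hρ => by
      rw [Set.uIoc_of_le zero_le_one] at hρ
      have h1 := hC ρ ⟨hρ.1.le, hρ.2⟩
      have h2 : ‖((ρ:ℂ) ^ 2) ^ s * ρ‖ ≤ 1 := by
        rw [← pow_mul, ← pow_succ, norm_pow, Complex.norm_real, Real.norm_of_nonneg hρ.1.le]
        exact pow_le_one₀ hρ.1.le hρ.2
      calc _ = ‖Complex.exp (-l * (ρ:ℂ) ^ 2)‖ *
            ‖2 * (Real.pi : ℂ) * ((a * b) ^ s / (s.factorial : ℂ) ^ 2)‖ *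
            ‖((ρ:ℂ) ^ 2) ^ s * ρ‖ := by
              rw [← norm_mul, ← norm_mul]
              congr 1
              ring
        _ ≤ C * ‖2 * (Real.pi : ℂ) * ((a * b) ^ s / (s.factorial : ℂ) ^ 2)‖ * 1 := by
              have := (norm_nonneg _).trans h1
              gcongr
        _ = _ := mul_one _)
    (.of_forall fun ρ _ => (hasSum_integral_exp_circle a b).summable.norm.mul_left C)
    (by simp)
    (.of_forall fun ρ _ => ((hasSum_integral_exp_circle (ρ * a) (ρ * b)).mul_left _).mul_right _)
  refine (hdom.mul_left (1 / (Real.pi : ℂ))).congr_fun fun s => ?_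
  rw [← two_mul_integral_gaussian_pow, ← intervalIntegral.integral_const_mul,
    ← intervalIntegral.integral_const_mul, div_mul_eq_mul_div, mul_div_assoc,
    ← intervalIntegral.integral_mul_const]
  congr 1 with ρ
  rw [show (ρ:ℂ) * a * (ρ * b) = (ρ:ℂ) ^ 2 * (a * b) by ring, mul_pow _ (a * b)]
  field_simp

lemma exp_GRBF_mul_fourier_kernel (l q r α φ ρ θ : ℝ) :
    Complex.exp (-(l : ℂ) * ((q:ℂ)^2 + (ρ:ℂ)^2 - 2 * (ρ:ℂ) * (q:ℂ) * (Real.cos (θ - α) : ℂ)))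
        * Complex.exp (2 * (Real.pi : ℂ) * Complex.I * (r:ℂ) * (ρ:ℂ) * (Real.cos (θ - φ) : ℂ))
      = Complex.exp (-(l : ℂ) * (q:ℂ)^2) * (Complex.exp (-(l : ℂ) * (ρ:ℂ) ^ 2) *
        Complex.exp
          ((ρ * (l * q * Complex.exp (-(α * Complex.I))
              + Real.pi * Complex.I * r * Complex.exp (-(φ * Complex.I))))
              * Complex.exp (θ * Complex.I)
            + (ρ * (l * q * Complex.exp (α * Complex.I)
              + Real.pi * Complex.I * r * Complex.exp (φ * Complex.I)))
              * Complex.exp (-(θ * Complex.I)))) := by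
  have hcos : ∀ x : ℝ, 2 * (Real.cos (θ - x) : ℂ)
      = Complex.exp (-(x * Complex.I)) * Complex.exp (θ * Complex.I)
        + Complex.exp (x * Complex.I) * Complex.exp (-(θ * Complex.I)) := by
    intro x
    rw [Complex.ofReal_cos, Complex.two_cos, ← Complex.exp_add, ← Complex.exp_add]
    push_cast
    congr 2 <;> ring
  simp_rw [← Complex.exp_add]
  congr 1
  linear_combination (l * ρ * q : ℂ) * hcos α + (Real.pi * Complex.I * r * ρ : ℂ) * hcos φ

lemma Om_eq_mul (l r φ q α : ℝ) :
    Om l r φ q α =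
      (l * q * Complex.exp (-(α * Complex.I))
        + Real.pi * Complex.I * r * Complex.exp (-(φ * Complex.I)))
      * (l * q * Complex.exp (α * Complex.I)
        + Real.pi * Complex.I * r * Complex.exp (φ * Complex.I)) := by
  have hinv : ∀ x : ℝ, Complex.exp (-(x * Complex.I)) * Complex.exp (x * Complex.I) = 1 := by
    intro x
    rw [← Complex.exp_add, neg_add_cancel, Complex.exp_zero]
  have hcos : 2 * (Real.cos (φ - α) : ℂ)
      = Complex.exp (-(α * Complex.I)) * Complex.exp (φ * Complex.I)
        + Complex.exp (α * Complex.I) * Complex.exp (-(φ * Complex.I)) := by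
    rw [Complex.ofReal_cos, Complex.two_cos, ← Complex.exp_add, ← Complex.exp_add]
    push_cast
    congr 2 <;> ring
  rw [Om]
  linear_combination (Real.pi * Complex.I * r * l * q : ℂ) * hcos
    - (l ^ 2 * q ^ 2 : ℂ) * hinv α - (Real.pi ^ 2 * r ^ 2 * Complex.I ^ 2 : ℂ) * hinv φ
    - (Real.pi ^ 2 * r ^ 2 : ℂ) * Complex.I_sq

theorem fourier_integral_GRBF_disk (l : ℝ) (hl : 0 < l) (q r : ℝ) (hq : 0 ≤ q) (hr : 0 ≤ r)
    (α φ : ℝ) :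
    ((1 / (Real.pi : ℂ)) *
        ∫ ρ in (0:ℝ)..1,
          (∫ θ in (0:ℝ)..(2 * Real.pi),
            Complex.exp (-(l : ℂ) * ((q:ℂ)^2 + (ρ:ℂ)^2 - 2 * (ρ:ℂ) * (q:ℂ) * (Real.cos (θ - α) : ℂ)))
              * Complex.exp (2 * (Real.pi : ℂ) * Complex.I * (r:ℂ) * (ρ:ℂ) * (Real.cos (θ - φ) : ℂ))
              * (ρ:ℂ))
      = Complex.exp (-(l : ℂ) * (q:ℂ)^2) *
          ∑' s : ℕ, (m s (l : ℂ) / ((Nat.factorial s : ℂ)) ^ 2) * (Om l r φ q α) ^ s)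
    ∧ Summable (fun s : ℕ =>
        ‖(m s (l : ℂ) / ((Nat.factorial s : ℂ)) ^ 2) * (Om l r φ q α) ^ s‖) := by
  have hsum := hasSum_m_mul_pow l
    (l * q * Complex.exp (-(α * Complex.I))
      + Real.pi * Complex.I * r * Complex.exp (-(φ * Complex.I)))
    (l * q * Complex.exp (α * Complex.I)
      + Real.pi * Complex.I * r * Complex.exp (φ * Complex.I))
  rw [← Om_eq_mul] at hsum
  refine ⟨?_, hsum.summable.norm⟩
  rw [hsum.tsum_eq]
  simp_rw [exp_GRBF_mul_fourier_kernel, intervalIntegral.integral_mul_const,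
    intervalIntegral.integral_const_mul, mul_assoc, intervalIntegral.integral_const_mul]
  ring
end
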